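/- Let 𝔤 be a finite-dimensional complex simple Lie algebra, 𝔥 ⊆ 𝔤 a Cartan subalgebra, Δ ⊆ Φ(𝔤,𝔥) a base of simple roots, and σ : 𝔤 → 𝔤 a conjugate-linear involution with σ(𝔥) = 𝔥 and σ*(Δ) = −Δ. Define μ : Δ → Δ by μ(α) = −σ*(α). Then there exists a choice of elements e_α ∈ 𝔤_α and e_{−α} ∈ 𝔤_{−α} for α ∈ Δ with [e_α, e_{−α}] = h_α, and a subset J of the fixed-point set {α ∈ Δ : μ(α) = α}, such that σ(e_α) = (−1)^{χ_J(α)} e_{−μ(α)} and σ(e_{−α}) = (−1)^{χ_J(α)} e_{μ(α)} for all α ∈ Δ, where χ_J is the characteristic function of J. -/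

import Mathlib

open scoped BigOperators

/-- A conjugate-linear involutive Lie algebra automorphism of a complex Lie algebra. -/
def IsConjLinearInvolution {L : Type*} [LieRing L] [LieAlgebra ℂ L] (σ : L → L) : Prop :=
  (∀ x y : L, σ (x + y) = σ x + σ y) ∧
  (∀ (z : ℂ) (x : L), σ (z • x) = (starRingEnd ℂ) z • σ x) ∧
  (∀ x y : L, σ ⁅x, y⁆ = ⁅σ x, σ y⁆) ∧
  (∀ x : L, σ (σ x) = x)

/-- `x` is a root vector for the functional `α` on the Cartan subalgebra `H`. -/
def IsRootVector {L : Type*} [LieRing L] [LieAlgebra ℂ L] (H : LieSubalgebra ℂ L)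
    (α : H → ℂ) (x : L) : Prop :=
  ∀ h : H, ⁅(h : L), x⁆ = α h • x

/-- `α` is a root of `(L, H)`: a nonzero functional admitting a nonzero root vector. -/
def IsRoot {L : Type*} [LieRing L] [LieAlgebra ℂ L] (H : LieSubalgebra ℂ L)
    (α : H → ℂ) : Prop :=
  α ≠ 0 ∧ ∃ x : L, x ≠ 0 ∧ IsRootVector H α x

/-- `Δ` is a base of simple roots for `(L, H)`: a linearly independent set of roots such
that every root is an integral combination of elements of `Δ` with coefficients that are
all nonnegative or all nonpositive. -/
def IsBase {L : Type*} [LieRing L] [LieAlgebra ℂ L] (H : LieSubalgebra ℂ L)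
    (Δ : Finset (H → ℂ)) : Prop :=
  (∀ α ∈ Δ, IsRoot H α) ∧
  (LinearIndependent ℂ (fun a : Δ => (a : H → ℂ))) ∧
  (∀ β : H → ℂ, IsRoot H β →
    ∃ c : (H → ℂ) → ℤ, ((∀ a ∈ Δ, 0 ≤ c a) ∨ (∀ a ∈ Δ, c a ≤ 0)) ∧
      β = ∑ a ∈ Δ, ((c a : ℂ) • a))

/-- The functional `σ*(α)`, given by `σ*(α)(h) = conj (α (σ h))`. -/
def sigmaStar {L : Type*} [LieRing L] [LieAlgebra ℂ L] (H : LieSubalgebra ℂ L)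
    (σ : L → L) (hH : ∀ x ∈ H, σ x ∈ H) (α : H → ℂ) : H → ℂ :=
  fun h => (starRingEnd ℂ) (α ⟨σ (h : L), hH (h : L) h.2⟩)

/-- `h` represents `α` via the Killing form: `h ∈ H` and `α(x) = κ(h, x)` for all `x ∈ H`. -/
def IsKillingDual {L : Type*} [LieRing L] [LieAlgebra ℂ L] (H : LieSubalgebra ℂ L)
    (h : L) (α : H → ℂ) : Prop :=
  h ∈ H ∧ ∀ x : H, α x = killingForm ℂ L h (x : L)


open LieAlgebra LieAlgebra.IsKilling LieModule

lemma LinearMap.trace_restrictScalars_eq {R S M : Type*} [CommRing R] [CommRing S] [Algebra R S]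
    [AddCommGroup M] [Module R M] [Module S M] [IsScalarTower R S M] [Module.Free R S]
    [Module.Finite R S] [Module.Free S M] [Module.Finite S M] (f : M →ₗ[S] M) :
    LinearMap.trace R M (f.restrictScalars R) = Algebra.trace R S (LinearMap.trace S M f) := by
  classical
  let b := Module.Free.chooseBasis R S
  let c := Module.Free.chooseBasis S M
  rw [LinearMap.trace_eq_matrix_trace R (b.smulTower c), LinearMap.trace_eq_matrix_trace S c,
    Matrix.trace, Matrix.trace, map_sum, Fintype.sum_prod_type_right]
  refine Finset.sum_congr rfl fun j _ ↦ ?_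
  rw [Algebra.trace_eq_matrix_trace b, Matrix.trace]
  refine Finset.sum_congr rfl fun i _ ↦ ?_
  simp [LinearMap.toMatrix_apply, Algebra.leftMulMatrix_eq_repr_mul, Module.Basis.smulTower_repr,
    mul_comm]

section RootVectors

variable {L : Type*} [LieRing L] [LieAlgebra ℂ L] {H : LieSubalgebra ℂ L}

/-- `e` and `f` are root vectors for `α` and `-α`, normalised by `κ(e, f) = 1`. -/
structure IsNormalizedPair (H : LieSubalgebra ℂ L) (α : H → ℂ) (e f : L) : Prop where
  pos : IsRootVector H α e
  neg : IsRootVector H (-α) f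
  killingForm_eq_one : killingForm ℂ L e f = 1

namespace IsNormalizedPair

variable {α : H → ℂ} {e f : L}

lemma left_ne_zero (h : IsNormalizedPair H α e f) : e ≠ 0 := by
  rintro rfl
  simpa using h.killingForm_eq_one

lemma right_ne_zero (h : IsNormalizedPair H α e f) : f ≠ 0 := by
  rintro rfl
  simpa using h.killingForm_eq_one

end IsNormalizedPair

lemma IsRootVector.smul {α : H → ℂ} {x : L} (hx : IsRootVector H α x) (z : ℂ) :
    IsRootVector H α (z • x) := fun h ↦ by
  rw [lie_smul, hx h, smul_comm]

variable [FiniteDimensional ℂ L] [IsKilling ℂ L] [H.IsCartanSubalgebra]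

lemma mem_rootSpace_iff_isRootVector {α : H → ℂ} {x : L} :
    x ∈ rootSpace H α ↔ IsRootVector H α x :=
  ⟨fun hx h ↦ lie_eq_smul_of_mem_rootSpace hx h,
    fun hx ↦ weightSpace_le_genWeightSpace L α ((mem_weightSpace α x).mpr hx)⟩

lemma IsRoot.exists_weight {α : H → ℂ} (hα : IsRoot H α) :
    ∃ χ : Weight ℂ H L, χ.IsNonZero ∧ (χ : H → ℂ) = α := by
  obtain ⟨h0, x, hx0, hx⟩ := hα
  refine ⟨⟨α, fun hbot ↦ hx0 ?_⟩, h0, rfl⟩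
  have := mem_rootSpace_iff_isRootVector.mpr hx
  rw [rootSpace, hbot] at this
  simpa using this

lemma IsRoot.exists_isNormalizedPair {α : H → ℂ} (hα : IsRoot H α) :
    ∃ e f : L, IsNormalizedPair H α e f := by
  obtain ⟨-, e, he0, he⟩ := hα
  obtain ⟨f, hf, hef⟩ : ∃ f ∈ rootSpace H (-α), killingForm ℂ L e f ≠ 0 := by
    contrapose! he0
    simpa using mem_ker_killingForm_of_mem_rootSpace_of_forall_rootSpace_neg ℂ L H
      (mem_rootSpace_iff_isRootVector.mpr he) he0
  refine ⟨e, (killingForm ℂ L e f)⁻¹ • f, he, (mem_rootSpace_iff_isRootVector.mp hf).smul _, ?_⟩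
  rw [map_smul, smul_eq_mul, inv_mul_cancel₀ hef]

lemma IsNormalizedPair.isKillingDual {α : H → ℂ} (hα : IsRoot H α) {e f : L}
    (h : IsNormalizedPair H α e f) : IsKillingDual H ⁅e, f⁆ α := by
  obtain ⟨χ, -, rfl⟩ := hα.exists_weight
  have hef := lie_eq_killingForm_smul_of_mem_rootSpace_of_mem_rootSpace_neg
    (mem_rootSpace_iff_isRootVector.mpr h.pos) (mem_rootSpace_iff_isRootVector.mpr h.neg)
  rw [h.killingForm_eq_one, one_smul] at hef
  rw [hef]
  exact ⟨Subtype.property _, fun x ↦ (LinearMap.BilinForm.apply_toDual_symm_apply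
    (hB := traceForm_cartan_nondegenerate ℂ L H) χ.toLinear x).symm⟩

lemma IsRoot.exists_smul_eq_of_isRootVector_neg {α : H → ℂ} (hα : IsRoot H α) {x y : L}
    (hx : IsRootVector H (-α) x) (hx0 : x ≠ 0) (hy : IsRootVector H (-α) y) :
    ∃ c : ℂ, c • x = y := by
  obtain ⟨χ, hχ, rfl⟩ := hα.exists_weight
  have hfin := finrank_rootSpace_eq_one (-χ) hχ.neg
  obtain ⟨c, hc⟩ := (finrank_eq_one_iff_of_nonzero'
    (⟨x, mem_rootSpace_iff_isRootVector.mpr hx⟩ : rootSpace H (-χ : Weight ℂ H L))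
    (by simpa using hx0)).mp hfin ⟨y, mem_rootSpace_iff_isRootVector.mpr hy⟩
  exact ⟨c, congrArg Subtype.val hc⟩

end RootVectors

namespace IsConjLinearInvolution

variable {L : Type*} [LieRing L] [LieAlgebra ℂ L] {H : LieSubalgebra ℂ L} {σ : L → L}

lemma map_neg (hσ : IsConjLinearInvolution σ) (x : L) : σ (-x) = -σ x := by
  simpa using hσ.2.1 (-1) x

lemma killingForm_map_map [FiniteDimensional ℂ L] (hσ : IsConjLinearInvolution σ) (x y : L) :
    killingForm ℂ L (σ x) (σ y) = (starRingEnd ℂ) (killingForm ℂ L x y) := by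
  obtain ⟨hadd, hsmul, hlie, hinv⟩ := hσ
  let e : L ≃ₗ[ℝ] L :=
    { toFun := σ
      invFun := σ
      map_add' := hadd
      map_smul' := fun r v ↦ by simpa using hsmul (r : ℂ) v
      left_inv := hinv
      right_inv := hinv }
  have htr (f : L →ₗ[ℂ] L) : (LinearMap.trace ℝ L) (f.restrictScalars ℝ) =
      2 * (LinearMap.trace ℂ L f).re := by
    rw [LinearMap.trace_restrictScalars_eq, Algebra.trace_complex_apply]
  have hre (x y : L) : (killingForm ℂ L (σ x) (σ y)).re = (killingForm ℂ L x y).re := by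
    have hconj : (ad ℂ L (σ x) ∘ₗ ad ℂ L (σ y)).restrictScalars ℝ =
        e.conj ((ad ℂ L x ∘ₗ ad ℂ L y).restrictScalars ℝ) := by
      ext v
      change ⁅σ x, ⁅σ y, v⁆⁆ = σ ⁅x, ⁅y, σ v⁆⁆
      rw [hlie, hlie, hinv]
    have := congrArg (LinearMap.trace ℝ L) hconj
    rw [LinearMap.trace_conj', htr, htr] at this
    simpa [killingForm_apply_apply] using this
  refine Complex.ext (by simpa using hre x y) ?_
  have := hre (Complex.I • x) y
  rw [hsmul] at this
  simp at this
  simp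
  linarith

lemma sigmaStar_sigmaStar (hσ : IsConjLinearInvolution σ) (hH : ∀ x ∈ H, σ x ∈ H)
    (α : H → ℂ) : sigmaStar H σ hH (sigmaStar H σ hH α) = α := by
  ext h
  simp [sigmaStar, hσ.2.2.2]

lemma isRootVector_map (hσ : IsConjLinearInvolution σ) (hH : ∀ x ∈ H, σ x ∈ H)
    {α : H → ℂ} {x : L} (hx : IsRootVector H α x) :
    IsRootVector H (sigmaStar H σ hH α) (σ x) := fun h ↦ by
  have := congrArg σ (hx ⟨σ h, hH h h.2⟩)
  rwa [hσ.2.2.1, hσ.2.2.2, hσ.2.1] at this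

lemma isNormalizedPair_map [FiniteDimensional ℂ L] (hσ : IsConjLinearInvolution σ)
    (hH : ∀ x ∈ H, σ x ∈ H) {α : H → ℂ} {e f : L}
    (h : IsNormalizedPair H α e f) :
    IsNormalizedPair H (-(sigmaStar H σ hH α)) (σ f) (σ e) where
  pos := by
    convert hσ.isRootVector_map hH h.neg using 1
    ext x
    simp [sigmaStar]
  neg := by
    rw [neg_neg]
    exact hσ.isRootVector_map hH h.pos
  killingForm_eq_one := by
    rw [hσ.killingForm_map_map, LieModule.traceForm_comm, h.killingForm_eq_one, map_one]

lemma exists_isNormalizedPair_of_fixed [FiniteDimensional ℂ L] [IsKilling ℂ L]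
    [H.IsCartanSubalgebra] (hσ : IsConjLinearInvolution σ) (hH : ∀ x ∈ H, σ x ∈ H) {α : H → ℂ}
    (hα : IsRoot H α) (hfix : -(sigmaStar H σ hH α) = α) :
    ∃ e f : L, IsNormalizedPair H α e f ∧ ((σ e = f ∧ σ f = e) ∨ (σ e = -f ∧ σ f = -e)) := by
  obtain ⟨e, f, h⟩ := hα.exists_isNormalizedPair
  have h' := hσ.isNormalizedPair_map hH h
  rw [hfix] at h'
  obtain ⟨c, hc⟩ := hα.exists_smul_eq_of_isRootVector_neg h.neg h.right_ne_zero h'.neg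
  have hc0 : c ≠ 0 := by
    rintro rfl
    exact h'.right_ne_zero (by rw [← hc, zero_smul])
  have he : e = (starRingEnd ℂ) c • σ f := by rw [← hσ.2.1, hc, hσ.2.2.2]
  have hreal : (starRingEnd ℂ) c = c := by
    have h1 := h'.killingForm_eq_one
    rw [← hc, map_smul, smul_eq_mul] at h1
    have h2 := h.killingForm_eq_one
    rw [LieModule.traceForm_comm, he, map_smul, smul_eq_mul, LieModule.traceForm_comm] at h2
    exact mul_right_cancel₀ (right_ne_zero_of_mul (h1.trans_ne one_ne_zero)) (h2.trans h1.symm)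
  obtain ⟨r, rfl⟩ := Complex.conj_eq_iff_real.mp hreal
  have hr : r ≠ 0 := by simpa using hc0
  have ht : √|r| ≠ 0 := Real.sqrt_ne_zero'.mpr (abs_pos.mpr hr)
  have htt : √|r| * √|r| = |r| := Real.mul_self_sqrt (abs_nonneg r)
  generalize √|r| = t at ht htt
  have htC : (t : ℂ) ≠ 0 := by simpa using ht
  have hσe : σ ((t⁻¹ : ℂ) • e) = (r / |r| : ℝ) • (t : ℂ) • f := by
    rw [hσ.2.1, ← hc, ← Complex.coe_smul, smul_smul, smul_smul, ← htt]
    congr 1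
    simp
    field_simp
  have hpair : IsNormalizedPair H α ((t⁻¹ : ℂ) • e) ((t : ℂ) • f) :=
    ⟨h.pos.smul _, h.neg.smul _, by simp [h.killingForm_eq_one, htC]⟩
  refine ⟨_, _, hpair, ?_⟩
  generalize (t⁻¹ : ℂ) • e = e' at *
  generalize (t : ℂ) • f = f' at *
  rcases hr.lt_or_gt with hneg | hpos
  · right
    rw [abs_of_neg hneg, div_neg, div_self hr, neg_one_smul] at hσe
    exact ⟨hσe, by rw [← neg_neg f', ← hσe, hσ.map_neg, hσ.2.2.2]⟩
  · left
    rw [abs_of_pos hpos, div_self hr, one_smul] at hσe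
    exact ⟨hσe, by rw [← hσe, hσ.2.2.2]⟩

end IsConjLinearInvolution

/-- if `σ` is a conjugate-linear involution preserving the Cartan subalgebra
`H` with `σ*(Δ) = -Δ`, and `μ(α) = -σ*(α)`, then there is a choice of elements
`e_α ∈ 𝔤_α`, `e_{-α} ∈ 𝔤_{-α}` with `[e_α, e_{-α}] = h_α` and a subset `J` of the
fixed-point set of `μ` in `Δ` such that `σ(e_α) = (-1)^{χ_J(α)} e_{-μ(α)}` and
`σ(e_{-α}) = (-1)^{χ_J(α)} e_{μ(α)}` for all simple roots `α`. -/
theorem exists_chevalley_generators_omega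
    (L : Type*) [LieRing L] [LieAlgebra ℂ L] [FiniteDimensional ℂ L]
    [LieAlgebra.IsSimple ℂ L]
    (H : LieSubalgebra ℂ L) [H.IsCartanSubalgebra]
    (Δ : Finset (H → ℂ)) (hΔ : IsBase H Δ)
    (σ : L → L) (hσ : IsConjLinearInvolution σ)
    (hH : ∀ x ∈ H, σ x ∈ H)
    (hantistable : (sigmaStar H σ hH) '' (Δ : Set (H → ℂ)) =
      (fun a : H → ℂ => -a) '' (Δ : Set (H → ℂ))) :
    ∃ (ep en : (H → ℂ) → L) (J : Set (H → ℂ)),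
      (J ⊆ {α : H → ℂ | α ∈ Δ ∧ -(sigmaStar H σ hH α) = α}) ∧
      ∀ α ∈ Δ,
        ep α ≠ 0 ∧ en α ≠ 0 ∧
        IsRootVector H α (ep α) ∧ IsRootVector H (-α) (en α) ∧
        IsKillingDual H ⁅ep α, en α⁆ α ∧
        (α ∈ J →
          σ (ep α) = -en (-(sigmaStar H σ hH α)) ∧
          σ (en α) = -ep (-(sigmaStar H σ hH α))) ∧
        (α ∉ J →
          σ (ep α) = en (-(sigmaStar H σ hH α)) ∧
          σ (en α) = ep (-(sigmaStar H σ hH α))) := by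
  classical
  set μ : (H → ℂ) → (H → ℂ) := fun α ↦ -(sigmaStar H σ hH α) with hμ
  have hμμ (α : H → ℂ) : μ (μ α) = α := by
    conv_rhs => rw [← hσ.sigmaStar_sigmaStar hH α]
    ext h
    simp [hμ, sigmaStar]
  have hμΔ (α : H → ℂ) (hα : α ∈ Δ) : μ α ∈ Δ := by
    obtain ⟨β, hβ, hβα⟩ := hantistable.subset (Set.mem_image_of_mem _ hα)
    simpa [hμ, ← hβα] using hβ
  have key (α : H → ℂ) : ∃ e f : L, α ∈ Δ → IsNormalizedPair H α e f ∧
      (μ α = α → (σ e = f ∧ σ f = e) ∨ (σ e = -f ∧ σ f = -e)) := by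
    by_cases hα : α ∈ Δ
    · by_cases hfix : μ α = α
      · obtain ⟨e, f, h, h'⟩ := hσ.exists_isNormalizedPair_of_fixed hH (hΔ.1 α hα) hfix
        exact ⟨e, f, fun _ ↦ ⟨h, fun _ ↦ h'⟩⟩
      · obtain ⟨e, f, h⟩ := (hΔ.1 α hα).exists_isNormalizedPair
        exact ⟨e, f, fun _ ↦ ⟨h, fun h' ↦ absurd h' hfix⟩⟩
    · exact ⟨0, 0, fun h ↦ absurd h hα⟩
  choose e f hef using key
  let r : (H → ℂ) → (H → ℂ) → Prop := WellOrderingRel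
  let ep : (H → ℂ) → L := fun α ↦ if r (μ α) α then σ (f (μ α)) else e α
  let en : (H → ℂ) → L := fun α ↦ if r (μ α) α then σ (e (μ α)) else f α
  have hpair (α : H → ℂ) (hα : α ∈ Δ) : IsNormalizedPair H α (ep α) (en α) := by
    by_cases h : r (μ α) α
    · have := hσ.isNormalizedPair_map hH (hef (μ α) (hμΔ α hα)).1
      change IsNormalizedPair H (μ (μ α)) _ _ at this
      rw [hμμ] at this
      simpa only [ep, en, if_pos h] using this
    · simpa only [ep, en, if_neg h] using (hef α hα).1
  refine ⟨ep, en, {α | α ∈ Δ ∧ μ α = α ∧ σ (e α) = -f α ∧ σ (f α) = -e α},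
    fun α hα ↦ ⟨hα.1, hα.2.1⟩, fun α hα ↦ ⟨(hpair α hα).left_ne_zero, (hpair α hα).right_ne_zero,
      (hpair α hα).pos, (hpair α hα).neg, (hpair α hα).isKillingDual (hΔ.1 α hα), ?_, ?_⟩⟩
  · rintro ⟨-, hfix, h⟩
    change σ (ep α) = -en (μ α) ∧ σ (en α) = -ep (μ α)
    simpa only [ep, en, hfix, if_neg (irrefl_of WellOrderingRel α), r] using h
  · intro hJ
    change σ (ep α) = en (μ α) ∧ σ (en α) = ep (μ α)
    rcases trichotomous_of WellOrderingRel (μ α) α with h | hfix | h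
    · simp only [ep, en, hμμ, r, if_pos h, if_neg (asymm_of WellOrderingRel h), hσ.2.2.2,
        and_self]
    · have h' := ((hef α hα).2 hfix).resolve_right fun h ↦ hJ ⟨hα, hfix, h⟩
      simpa only [ep, en, hfix, if_neg (irrefl_of WellOrderingRel α), r] using h'
    · simp only [ep, en, hμμ, r, if_pos h, if_neg (asymm_of WellOrderingRel h), and_self]
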